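/- For a job g ∈ B1 write x_{g1} = ⌊x_{g1}⌋ + ε_g, β_g = ⌊β_g⌋ + λ_g and α_g = ⌊α_g⌋ + ω_g with 0 ≤ λ_g, ω_g < 1 and 0 < ε_g < 1, where α_g = Σ_{h∈G1} y_{gh} and β_g = Σ_{h∈G2} y_{gh}. Then ω_g = ε_g; moreover λ_g = ε − ε_g if ε ≥ ε_g, and λ_g = 1 − (ε_g − ε) if ε < ε_g. -/

import Mathlib

open Finset

noncomputable section

/-- Feasibility for system `S`. -/
def FeasibleS {J M : Type*} [Fintype J] [Fintype M]
    (G1 G2 : Finset M) (b : J → M → ℕ) (a1 a2 : J → ℕ)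
    (y : J → M → ℝ) (x1 x2 : J → ℝ) (r w : ℝ) : Prop :=
  (∀ h ∈ G1, ((∑ j, (b j h : ℝ)) - ((∑ j, (a2 j : ℝ)) - r) ≤ (∑ j, y j h)) ∧
    ((∑ j, y j h) ≤ w)) ∧
  (∀ h ∈ G2, ((∑ j, (b j h : ℝ)) - ((∑ j, (a1 j : ℝ)) - r) ≤ (∑ j, y j h)) ∧
    ((∑ j, y j h) ≤ w)) ∧
  (∀ j, (∑ h, y j h) ≤ w) ∧
  (∀ j, ∀ h, 0 ≤ y j h ∧ y j h ≤ (b j h : ℝ)) ∧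
  ((∑ j, x1 j) = r) ∧ ((∑ j, x2 j) = r) ∧
  (∀ j, x1 j + x2 j ≤ r) ∧
  (∀ j, 0 ≤ x1 j ∧ x1 j ≤ (a1 j : ℝ)) ∧
  (∀ j, 0 ≤ x2 j ∧ x2 j ≤ (a2 j : ℝ)) ∧
  (∀ j, (∑ h ∈ G1, ((b j h : ℝ) - y j h)) + (a2 j : ℝ) - x2 j ≤ (∑ j', (a2 j' : ℝ)) - r) ∧
  (∀ j, (∑ h ∈ G2, ((b j h : ℝ) - y j h)) + (a1 j : ℝ) - x1 j ≤ (∑ j', (a1 j' : ℝ)) - r)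

/-- Feasibility for the linear program `ℓp` associated with an optimal
LP-relaxation value `(rstar, wstar)`. -/
def FeasibleLP {J M : Type*} [Fintype J] [Fintype M]
    (G1 G2 : Finset M) (b : J → M → ℕ) (a1 a2 : J → ℕ)
    (rstar wstar : ℝ)
    (y : J → M → ℝ) (x1 x2 : J → ℝ) (r w : ℝ) : Prop :=
  FeasibleS G1 G2 b a1 a2 y x1 x2 r w ∧
  w - r = (⌈wstar - rstar⌉ : ℝ) ∧ ((⌊rstar⌋ : ℝ) ≤ r)


theorem aux_farkas {V : Type*} [AddCommGroup V] [Module ℚ V] (n : ℕ) :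
    ∀ (a : Fin n → V →ₗ[ℚ] ℚ) (c : V →ₗ[ℚ] ℚ),
      (∀ x, (∀ i, a i x ≤ 0) → c x ≤ 0) →
      ∃ l : Fin n → ℚ, (∀ i, 0 ≤ l i) ∧ ∀ x, c x = ∑ i, l i * a i x := by
  induction n with
  | zero =>
    intro a c h
    refine ⟨fun _ => 0, fun _ => le_rfl, fun x => ?_⟩
    have h1 := h x (fun i => i.elim0)
    have h2 := h (-x) (fun i => i.elim0)
    simp at h2 ⊢
    linarith
  | succ n ih =>
    intro a c h
    by_cases hc : ∀ x, (∀ i : Fin n, a i.succ x ≤ 0) → c x ≤ 0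
    · obtain ⟨l, hl, hx⟩ := ih (fun i => a i.succ) c hc
      refine ⟨Fin.cons 0 l, ?_, ?_⟩
      · intro i
        refine Fin.cases ?_ ?_ i
        · simp
        · intro i; simpa using hl i
      · intro x
        rw [Fin.sum_univ_succ]
        simpa using hx x
    · push Not at hc
      obtain ⟨x0, hx0, hcx0⟩ := hc
      have ha0 : 0 < a 0 x0 := by
        by_contra hneg
        push Not at hneg
        have := h x0 (fun i => by
          refine Fin.cases hneg hx0 i)
        linarith
      set u := a 0 x0 with hu
      obtain ⟨l, hl, hx⟩ := ih (fun i => a i.succ - (a i.succ x0 / u) • a 0)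
        (c - (c x0 / u) • a 0) (by
          intro x hxx
          have key := h (x - (a 0 x / u) • x0) (by
            intro i
            refine Fin.cases ?_ ?_ i
            · simp only [map_sub, map_smul, smul_eq_mul, ← hu]
              field_simp
              simp
            · intro i
              have := hxx i
              simp only [map_sub, map_smul, smul_eq_mul, LinearMap.sub_apply,
                LinearMap.smul_apply] at this ⊢
              calc _ = (a i.succ) x - (a i.succ) x0 / u * (a 0) x := by ring
                _ ≤ 0 := this)
          simp only [map_sub, map_smul, smul_eq_mul, LinearMap.sub_apply,
                LinearMap.smul_apply] at key ⊢
          calc _ = c x - (a 0) x / u * c x0 := by ring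
            _ ≤ 0 := key)
      refine ⟨Fin.cons (c x0 / u - ∑ i, l i * (a i.succ x0 / u)) l, ?_, ?_⟩
      · intro i
        refine Fin.cases ?_ ?_ i
        · simp only [Fin.cons_zero]
          have : ∑ i, l i * (a i.succ x0 / u) ≤ 0 := by
            apply Finset.sum_nonpos
            intro i _
            exact mul_nonpos_of_nonneg_of_nonpos (hl i)
              (div_nonpos_of_nonpos_of_nonneg (hx0 i) ha0.le)
          have : 0 ≤ c x0 / u := by positivity
          linarith
        · intro i; simpa using hl i
      · intro x
        have := hx x
        rw [Fin.sum_univ_succ]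
        simp only [LinearMap.sub_apply, LinearMap.smul_apply, smul_eq_mul, Fin.cons_zero,
          Fin.cons_succ, mul_sub, Finset.sum_sub_distrib] at this ⊢
        rw [sub_mul, Finset.sum_mul]
        have e : ∑ i, l i * (a i.succ x0 / u) * a 0 x = ∑ i, l i * (a i.succ x0 / u * a 0 x) :=
          Finset.sum_congr rfl (fun i _ => by ring)
        rw [e]
        linarith

/-- Clearing denominators of a finite family of nonnegative rationals. -/
theorem aux_clear {κ : Type*} [Fintype κ] (l : κ → ℚ) (hl : ∀ i, 0 ≤ l i) :
    ∃ (N : ℕ) (l' : κ → ℕ), 0 < N ∧ ∀ i, (l' i : ℚ) = N * l i := by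
  classical
  refine ⟨∏ i, (l i).den, fun i => (l i).num.toNat * ∏ j ∈ univ.erase i, (l j).den,
    Finset.prod_pos (fun i _ => (l i).den_pos), ?_⟩
  intro i
  have h1 : ((l i).num.toNat : ℚ) = (l i).num := by
    have : ((l i).num.toNat : ℤ) = (l i).num := Int.toNat_of_nonneg (Rat.num_nonneg.mpr (hl i))
    exact_mod_cast this
  rw [← Finset.mul_prod_erase univ _ (mem_univ i)]
  push_cast
  rw [h1]
  have h2 : ((l i).den : ℚ) * l i = (l i).num := by
    exact Rat.den_mul_eq_num (l i)
  rw [← h2]; ring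

/-- LP duality with integer matrix, inequality form. -/
theorem aux_lp {κ W : Type*} [Fintype κ] [Fintype W]
    (A : κ → W → ℤ) (c : κ → ℝ) (obj : W → ℤ) (X : W → ℝ)
    (hX : ∀ k, ∑ v, (A k v : ℝ) * X v ≤ c k)
    (hopt : ∀ X' : W → ℝ, (∀ k, ∑ v, (A k v : ℝ) * X' v ≤ c k) →
      ∑ v, (obj v : ℝ) * X v ≤ ∑ v, (obj v : ℝ) * X' v) :
    ∃ (N : ℕ) (l : κ → ℕ), 0 < N ∧ (∀ k, ∑ v, (A k v : ℝ) * X v < c k → l k = 0) ∧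
      ∀ v, ∑ k, (l k : ℤ) * A k v + N * obj v = 0 := by
  classical
  let fn : (W → ℤ) → ((W → ℚ) →ₗ[ℚ] ℚ) := fun a =>
    ∑ v, (a v : ℚ) • LinearMap.proj v
  have hfn : ∀ a x, fn a x = ∑ v, (a v : ℚ) * x v := by
    intro a x; simp [fn]
  let act : κ → Prop := fun k => ∑ v, (A k v : ℝ) * X v = c k
  let e := Fintype.equivFin κ
  obtain ⟨l, hl, hlx⟩ := aux_farkas (V := W → ℚ) (Fintype.card κ)
    (fun i => if act (e.symm i) then fn (A (e.symm i)) else 0) (- fn obj) (by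
      intro d hd
      by_contra hneg
      push Not at hneg
      have hd' : ∀ k, act k → ∑ v, (A k v : ℝ) * (d v : ℝ) ≤ 0 := by
        intro k hk
        have := hd (e k)
        simp only [Equiv.symm_apply_apply, hk, if_true, hfn] at this
        exact_mod_cast this
      have hobj : ∑ v, (obj v : ℝ) * (d v : ℝ) < 0 := by
        simp only [LinearMap.neg_apply, hfn] at hneg
        have : ∑ v, (obj v : ℚ) * d v < 0 := by linarith
        exact_mod_cast this
      have hstep : ∀ k, ∀ᶠ δ : ℝ in nhdsWithin 0 (Set.Ioi 0),
          ∑ v, (A k v : ℝ) * (X v + δ * d v) ≤ c k := by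
        intro k
        have hsplit : ∀ δ : ℝ, ∑ v, (A k v : ℝ) * (X v + δ * d v) =
            ∑ v, (A k v : ℝ) * X v + δ * ∑ v, (A k v : ℝ) * (d v : ℝ) := by
          intro δ
          rw [Finset.mul_sum, ← Finset.sum_add_distrib]
          exact Finset.sum_congr rfl (fun v _ => by ring)
        by_cases hk : act k
        · filter_upwards [self_mem_nhdsWithin] with δ hδ
          rw [hsplit, hk]
          have := mul_nonpos_of_nonneg_of_nonpos (le_of_lt hδ) (hd' k hk)
          linarith
        · have hlt : ∑ v, (A k v : ℝ) * X v < c k := lt_of_le_of_ne (hX k) hk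
          have hcont : Continuous (fun δ : ℝ => ∑ v, (A k v : ℝ) * (X v + δ * d v)) := by
            fun_prop
          have : ∀ᶠ δ : ℝ in nhds 0, ∑ v, (A k v : ℝ) * (X v + δ * d v) < c k := by
            apply hcont.continuousAt.eventually_lt_const
            simpa using hlt
          exact (this.filter_mono nhdsWithin_le_nhds).mono (fun δ h => h.le)
      have hall : ∀ᶠ δ : ℝ in nhdsWithin 0 (Set.Ioi 0), ∀ k,
          ∑ v, (A k v : ℝ) * (X v + δ * d v) ≤ c k := by
        rw [Filter.eventually_all]; exact hstep
      obtain ⟨δ, hδ, hδ0⟩ := (hall.and self_mem_nhdsWithin).exists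
      have := hopt (fun v => X v + δ * d v) hδ
      have hsplit : ∑ v, (obj v : ℝ) * (X v + δ * d v) =
            ∑ v, (obj v : ℝ) * X v + δ * ∑ v, (obj v : ℝ) * (d v : ℝ) := by
        rw [Finset.mul_sum, ← Finset.sum_add_distrib]
        exact Finset.sum_congr rfl (fun v _ => by ring)
      rw [hsplit] at this
      have := mul_neg_of_pos_of_neg (show (0:ℝ) < δ from hδ0) hobj
      linarith)
  obtain ⟨N, l', hN, hl'⟩ := aux_clear (fun k => if act k then l (e k) else 0) (by
    intro k
    split_ifs
    · exact hl _
    · exact le_rfl)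
  refine ⟨N, l', hN, ?_, ?_⟩
  · intro k hk
    have hna : ¬ act k := hk.ne
    have := hl' k
    simp only [hna, if_false, mul_zero] at this
    exact_mod_cast this
  · intro v
    have h1 := hlx (Pi.single v 1)
    have hs : ∀ a : W → ℤ, fn a (Pi.single v 1) = a v := by
      intro a; rw [hfn]; simp [Pi.single_apply]
    simp only [LinearMap.neg_apply, hs] at h1
    have h2 : (∑ k, (l' k : ℚ) * A k v) + N * obj v = 0 := by
      have h3 : ∑ k, (l' k : ℚ) * A k v = N * ∑ i, l i *
          (if act (e.symm i) then fn (A (e.symm i)) else 0) (Pi.single v 1) := by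
        rw [Finset.mul_sum, ← Equiv.sum_comp e]
        refine Finset.sum_congr rfl (fun k _ => ?_)
        rw [hl' k, Equiv.symm_apply_apply]
        by_cases hk : act k
        · simp only [hk, if_true, hs]; ring
        · simp [hk]
      rw [h3, ← h1]; ring
    exact_mod_cast h2

/-- LP duality with equalities, inequalities, and box constraints. -/
theorem aux_lp2 {η ι W : Type*} [Fintype η] [Fintype ι] [Fintype W]
    (E : η → W → ℤ) (ce : η → ℝ) (A : ι → W → ℤ) (c : ι → ℝ) (lo up : W → ℝ)
    (obj : W → ℤ) (X : W → ℝ)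
    (hE : ∀ k, ∑ v, (E k v : ℝ) * X v = ce k)
    (hX : ∀ k, ∑ v, (A k v : ℝ) * X v ≤ c k)
    (hlo : ∀ v, lo v ≤ X v) (hup : ∀ v, X v ≤ up v)
    (hopt : ∀ X' : W → ℝ, (∀ k, ∑ v, (E k v : ℝ) * X' v = ce k) →
      (∀ k, ∑ v, (A k v : ℝ) * X' v ≤ c k) → (∀ v, lo v ≤ X' v) → (∀ v, X' v ≤ up v) →
      ∑ v, (obj v : ℝ) * X v ≤ ∑ v, (obj v : ℝ) * X' v) :
    ∃ (N : ℕ) (m : η → ℤ) (l : ι → ℕ), 0 < N ∧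
      (∀ k, ∑ v, (A k v : ℝ) * X v < c k → l k = 0) ∧
      (∀ v, lo v < X v → ∑ k, m k * E k v + ∑ k, (l k : ℤ) * A k v + N * obj v ≤ 0) ∧
      (∀ v, X v < up v → 0 ≤ ∑ k, m k * E k v + ∑ k, (l k : ℤ) * A k v + N * obj v) := by
  classical
  let AA : (η ⊕ η) ⊕ (ι ⊕ (W ⊕ W)) → W → ℤ := fun k v => match k with
    | .inl (.inl k) => E k v
    | .inl (.inr k) => - E k v
    | .inr (.inl k) => A k v
    | .inr (.inr (.inl u)) => if u = v then -1 else 0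
    | .inr (.inr (.inr u)) => if u = v then 1 else 0
  let cc : (η ⊕ η) ⊕ (ι ⊕ (W ⊕ W)) → ℝ := fun k => match k with
    | .inl (.inl k) => ce k
    | .inl (.inr k) => - ce k
    | .inr (.inl k) => c k
    | .inr (.inr (.inl u)) => - lo u
    | .inr (.inr (.inr u)) => up u
  have e1 : ∀ (Z : W → ℝ) k, ∑ v, (AA (.inl (.inl k)) v : ℝ) * Z v = ∑ v, (E k v : ℝ) * Z v :=
    fun Z k => rfl
  have e2 : ∀ (Z : W → ℝ) k, ∑ v, (AA (.inl (.inr k)) v : ℝ) * Z v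
      = - ∑ v, (E k v : ℝ) * Z v := by
    intro Z k; simp [AA]
  have e3 : ∀ (Z : W → ℝ) k, ∑ v, (AA (.inr (.inl k)) v : ℝ) * Z v = ∑ v, (A k v : ℝ) * Z v :=
    fun Z k => rfl
  have e4 : ∀ (Z : W → ℝ) u, ∑ v, (AA (.inr (.inr (.inl u))) v : ℝ) * Z v = - Z u := by
    intro Z u; simp [AA]
  have e5 : ∀ (Z : W → ℝ) u, ∑ v, (AA (.inr (.inr (.inr u))) v : ℝ) * Z v = Z u := by
    intro Z u; simp [AA]
  obtain ⟨N, l, hN, hl0, hl⟩ := aux_lp AA cc obj X (by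
      rintro ((k | k) | (k | (k | k)))
      · rw [e1]; exact (hE k).le
      · rw [e2]; exact (neg_le_neg (hE k).ge)
      · rw [e3]; exact hX k
      · rw [e4]; exact neg_le_neg (hlo k)
      · rw [e5]; exact hup k) (by
      intro X' h
      apply hopt X'
      · intro k
        have h1 := h (.inl (.inl k))
        have h2 := h (.inl (.inr k))
        rw [e1] at h1; rw [e2] at h2
        exact le_antisymm h1 (neg_le_neg_iff.mp h2)
      · intro k; exact h (.inr (.inl k))
      · intro k
        have := h (.inr (.inr (.inl k)))
        rw [e4] at this; exact neg_le_neg_iff.mp this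
      · intro k
        have := h (.inr (.inr (.inr k)))
        rw [e5] at this; exact this)
  have hv : ∀ v, ∑ k, ((l (.inl (.inl k)) : ℤ) - l (.inl (.inr k))) * E k v
      + ∑ k, (l (.inr (.inl k)) : ℤ) * A k v + N * obj v
      = l (.inr (.inr (.inl v))) - l (.inr (.inr (.inr v))) := by
    intro v
    have := hl v
    simp only [Fintype.sum_sum_type, AA, mul_ite, mul_neg, mul_one, mul_zero,
      Finset.sum_ite_eq', Finset.mem_univ, if_true, Finset.sum_neg_distrib] at this
    simp only [sub_mul, Finset.sum_sub_distrib]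
    linarith
  refine ⟨N, fun k => (l (.inl (.inl k)) : ℤ) - l (.inl (.inr k)),
    fun k => l (.inr (.inl k)), hN, ?_, ?_, ?_⟩
  · intro k hk; exact hl0 _ hk
  · intro v h
    rw [hv, hl0 (.inr (.inr (.inl v))) (by rw [e4]; exact neg_lt_neg h)]
    simp
  · intro v h
    rw [hv, hl0 (.inr (.inr (.inr v))) (by rw [e5]; exact h)]
    simp


def auxZ : AddSubgroup ℝ := (Int.castAddHom ℝ).range

lemma auxZ_int (z : ℤ) : (z : ℝ) ∈ auxZ := ⟨z, rfl⟩

lemma auxZ_mul (z : ℤ) {x : ℝ} (hx : x ∈ auxZ) : (z : ℝ) * x ∈ auxZ := by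
  obtain ⟨y, rfl⟩ := hx
  exact ⟨z * y, by simp⟩

lemma aux_part {V E : Type*} [Fintype V] [DecidableEq V] [DecidableEq E] (f g : E → V)
    (D : Finset E) : ∃ p : V → V, (∀ e ∈ D, p (f e) = p (g e)) ∧
      ∀ c, #{v | p v = c} ≤ #{e ∈ D | p (f e) = c} + 1 := by
  induction D using Finset.induction_on with
  | empty =>
    refine ⟨id, by simp, fun c => ?_⟩
    simp [Finset.filter_eq']
  | insert e D he ih =>
    obtain ⟨p, h1, h2⟩ := ih
    by_cases hpe : p (f e) = p (g e)
    · refine ⟨p, ?_, fun c => ?_⟩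
      · intro e' he'
        rcases Finset.mem_insert.1 he' with rfl | h
        · exact hpe
        · exact h1 _ h
      · refine (h2 c).trans ?_
        gcongr
        exact Finset.subset_insert _ _
    · refine ⟨fun v => if p v = p (g e) then p (f e) else p v, ?_, fun c => ?_⟩
      · intro e' he'
        rcases Finset.mem_insert.1 he' with rfl | h
        · simp [hpe]
        · simp only [h1 _ h]
      · by_cases hc : c = p (f e)
        · have e1 : ({v | (if p v = p (g e) then p (f e) else p v) = c} : Finset V)
              ⊆ ({v | p v = p (f e)} : Finset V) ∪ ({v | p v = p (g e)} : Finset V) := by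
            intro v; simp only [mem_filter, mem_univ, true_and, mem_union]
            split_ifs with h
            · intro _; exact Or.inr h
            · intro h'; exact Or.inl (h'.trans hc)
          have e2 : insert e (({x ∈ D | p (f x) = p (f e)} : Finset E) ∪ {x ∈ D | p (f x) = p (g e)}) ⊆
             ({x ∈ insert e D | (if p (f x) = p (g e) then p (f e) else p (f x)) = c} : Finset E) := by
            intro x
            simp only [mem_insert, mem_union, mem_filter]
            rintro (rfl | ⟨h, h'⟩ | ⟨h, h'⟩)
            · simp [hpe, hc]
            · simp [h, h', hpe, hc]
            · simp [h, h', hc]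
          have c1 := (card_le_card e1).trans (card_union_le _ _)
          have c2 := card_le_card e2
          rw [card_insert_of_notMem (by simp [he]), card_union_of_disjoint] at c2
          · have := h2 (p (f e)); have := h2 (p (g e)); beta_reduce; omega
          · rw [Finset.disjoint_left]
            intro x hx hx'
            simp only [mem_filter] at hx hx'
            exact hpe (hx.2.symm.trans hx'.2)
        · by_cases hc' : c = p (g e)
          · have : ({v | (if p v = p (g e) then p (f e) else p v) = c} : Finset V) = ∅ := by
              ext v; simp only [mem_filter, mem_univ, true_and, notMem_empty, iff_false]
              split_ifs with h
              · exact fun h' => hc h'.symm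
              · exact fun h' => h (h'.trans hc')
            rw [this]; simp
          · refine le_trans (card_le_card ?_) ((h2 c).trans (Nat.add_le_add_right (card_le_card ?_) 1))
            · intro v; simp only [mem_filter, mem_univ, true_and]
              split_ifs with h
              · exact fun h' => absurd h'.symm hc
              · exact id
            · intro x; simp only [mem_filter, mem_insert]
              rintro ⟨h, h'⟩
              refine ⟨Or.inr h, ?_⟩
              rw [if_neg]
              · exact h'
              · rw [h']; exact hc'

lemma aux_resid (L : ℕ) [NeZero L] (x : ℤ) (P : ZMod L → Prop) [DecidablePred P] :
    #{θ ∈ Finset.Ico x (x + L) | P ((θ : ℤ) : ZMod L)} = #{u | P u} := by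
  have hinj : Set.InjOn (fun θ : ℤ => (θ : ZMod L)) (Finset.Ico x (x+L) : Finset ℤ) := by
    intro a ha b hb hab
    simp only [coe_Ico, Set.mem_Ico] at ha hb
    have := (ZMod.intCast_eq_intCast_iff_dvd_sub a b L).1 hab
    obtain ⟨q, hq⟩ := this
    have hL : (0:ℤ) < L := by exact_mod_cast Nat.pos_of_ne_zero (NeZero.ne L)
    have h1 : q < 1 := by by_contra h; push Not at h; nlinarith
    have h2 : -1 < q := by by_contra h; push Not at h; nlinarith
    have : q = 0 := by omega
    subst this; omega
  have himg : (Finset.Ico x (x+L)).image (fun θ : ℤ => (θ : ZMod L)) = univ := by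
    apply Finset.eq_univ_of_card
    rw [Finset.card_image_of_injOn hinj, ZMod.card]; simp
  rw [← himg, Finset.filter_image, Finset.card_image_of_injOn]
  exact hinj.mono (by intro a; simp; tauto)

lemma aux_count {J : Type*} [DecidableEq J] (L K : ℕ) (r : ℝ) (hr : r ∉ auxZ) (F : ℤ → ℤ) (S : Finset ℤ)
    (hF0 : ∀ θ ∈ S, 0 ≤ F θ) (B1 B2 : Finset J) (x y : J → ℤ) (s t : J → ℝ)
    (hs : ∑ i ∈ B1, s i - r ∈ auxZ) (ht : ∑ i ∈ B2, t i - r ∈ auxZ)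
    (hx : ∀ i ∈ B1, ∀ θ ∈ Finset.Ico (x i) (x i + L), θ ∈ S ∧ 1 ≤ F θ)
    (hy : ∀ i ∈ B2, ∀ θ ∈ Finset.Ico (y i) (y i + K), θ ∈ S ∧ 1 ≤ F θ)
    (hmod : ∀ θ ∈ S, r * F θ - (∑ i ∈ B1, (if θ ∈ Finset.Ico (x i) (x i + L) then s i else 0)
      + ∑ i ∈ B2, (if θ ∈ Finset.Ico (y i) (y i + K) then t i else 0)) ∈ auxZ) :
    (L + K : ℤ) ≤ ∑ θ ∈ S, F θ := by
  classical
  have base : ∀ (B : Finset J) (x : J → ℤ) (s : J → ℝ) (L : ℕ), ∑ i ∈ B, s i - r ∈ auxZ →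
     (∀ i ∈ B, ∀ θ ∈ Finset.Ico (x i) (x i + L), θ ∈ S ∧ 1 ≤ F θ) → (L:ℤ) ≤ ∑ θ ∈ S, F θ := by
    intro B x s L hs hx
    have : B.Nonempty := by
      rw [Finset.nonempty_iff_ne_empty]; rintro rfl
      apply hr; have := auxZ.neg_mem hs; simpa using this
    obtain ⟨i, hi⟩ := this
    calc (L:ℤ) = ∑ θ ∈ Finset.Ico (x i) (x i + L), 1 := by simp
      _ ≤ ∑ θ ∈ Finset.Ico (x i) (x i + L), F θ := sum_le_sum fun θ h => (hx i hi θ h).2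
      _ ≤ _ := sum_le_sum_of_subset_of_nonneg (fun θ h => (hx i hi θ h).1) (fun θ h _ => hF0 θ h)
  rcases Nat.eq_zero_or_pos L with rfl | hL
  · simpa using base B2 y t K ht hy
  rcases Nat.eq_zero_or_pos K with rfl | hK
  · simpa using base B1 x s L hs hx
  have : NeZero L := ⟨hL.ne'⟩
  have : NeZero K := ⟨hK.ne'⟩
  set D := S.filter (fun θ => 1 ≤ F θ) with hD
  obtain ⟨p, hp1, hp2⟩ := aux_part (V := ZMod L ⊕ ZMod K) (fun θ : ℤ => Sum.inl (θ : ZMod L))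
    (fun θ : ℤ => Sum.inr (θ : ZMod K)) D
  have hcls : ∀ c, (#{v | p v = c} : ℤ) ≤ ∑ θ ∈ D.filter (fun θ : ℤ => p (Sum.inl (θ : ZMod L)) = c), F θ := by
    intro c
    set Dc := D.filter (fun θ : ℤ => p (Sum.inl (θ : ZMod L)) = c) with hDc
    have h1 : (#Dc : ℤ) ≤ ∑ θ ∈ Dc, F θ := by
      calc (#Dc : ℤ) = ∑ θ ∈ Dc, 1 := by simp
        _ ≤ _ := sum_le_sum fun θ h => by
          simp only [hDc, hD, mem_filter] at h; exact h.1.2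
    have h2 := hp2 c
    have hsum : r * ((∑ θ ∈ Dc, F θ : ℤ):ℝ) - r * (#{v | p v = c} : ℕ) ∈ auxZ := by
      have hm : ∑ θ ∈ Dc, (r * F θ - (∑ i ∈ B1, (if θ ∈ Finset.Ico (x i) (x i + L) then s i else 0)
          + ∑ i ∈ B2, (if θ ∈ Finset.Ico (y i) (y i + K) then t i else 0))) ∈ auxZ :=
        auxZ.sum_mem fun θ h => hmod θ (by simp only [hDc, hD, mem_filter] at h; exact h.1.1)
      have e1 : ∀ i ∈ B1, ∑ θ ∈ Dc, (if θ ∈ Finset.Ico (x i) (x i + L) then s i else 0)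
          = (#{u : ZMod L | p (Sum.inl u) = c} : ℕ) * s i := by
        intro i hi
        rw [← aux_resid L (x i), ← Finset.sum_filter, sum_const, nsmul_eq_mul]
        congr 3
        ext θ
        simp only [hDc, hD, mem_filter]
        constructor
        · tauto
        · intro h; have := hx i hi θ h.1; tauto
      have e2 : ∀ i ∈ B2, ∑ θ ∈ Dc, (if θ ∈ Finset.Ico (y i) (y i + K) then t i else 0)
          = (#{u : ZMod K | p (Sum.inr u) = c} : ℕ) * t i := by
        intro i hi
        rw [← aux_resid K (y i), ← Finset.sum_filter, sum_const, nsmul_eq_mul]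
        congr 3
        ext θ
        simp only [hDc, hD, mem_filter]
        constructor
        · rintro ⟨⟨h, h'⟩, h''⟩
          exact ⟨h'', by rw [← hp1 θ (by simp only [hD, mem_filter]; exact h)]; exact h'⟩
        · intro h; have h3 := hy i hi θ h.1
          refine ⟨⟨h3, ?_⟩, h.1⟩
          rw [hp1 θ (by simp only [hD, mem_filter]; exact h3)]; exact h.2
      rw [sum_sub_distrib, sum_add_distrib, sum_comm, sum_congr rfl e1, sum_comm, sum_congr rfl e2,
        ← mul_sum, ← mul_sum, ← mul_sum] at hm
      have hc : (#{v | p v = c} : ℕ) = #{u : ZMod L | p (Sum.inl u) = c} + #{u : ZMod K | p (Sum.inr u) = c} := by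
        simp only [Finset.card_filter, Fintype.sum_sum_type]
      have := auxZ.add_mem hm (auxZ.add_mem (auxZ_mul (#{u : ZMod L | p (Sum.inl u) = c} : ℕ) hs)
        (auxZ_mul (#{u : ZMod K | p (Sum.inr u) = c} : ℕ) ht))
      convert this using 1
      rw [hc]; push_cast; ring
    by_contra hlt
    push Not at hlt
    have : ((∑ θ ∈ Dc, F θ : ℤ)) = (#{v | p v = c} : ℕ) - 1 := by
      have : (#{v | p v = c} : ℤ) ≤ #Dc + 1 := by exact_mod_cast h2
      omega
    apply hr
    rw [this] at hsum
    have := auxZ.neg_mem hsum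
    convert this using 1
    push_cast; ring
  calc (L + K : ℤ) = ∑ c, (#{v | p v = c} : ℤ) := by
        have := Finset.card_eq_sum_card_fiberwise (f := p) (s := univ) (t := univ) (by simp)
        rw [← Nat.cast_sum, ← this]; simp [ZMod.card]
    _ ≤ ∑ c, ∑ θ ∈ D.filter (fun θ : ℤ => p (Sum.inl (θ : ZMod L)) = c), F θ := sum_le_sum fun c _ => hcls c
    _ = ∑ θ ∈ D, F θ := Finset.sum_fiberwise _ _ _
    _ ≤ _ := sum_le_sum_of_subset_of_nonneg (filter_subset _ _) (fun θ h _ => hF0 θ h)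

lemma aux_ex_nonint {J : Type*} [Fintype J] (s : J → ℝ) (r : ℝ) (hr : r ∉ auxZ)
    (hs : ∑ j, s j = r) : ∃ i, s i ∉ auxZ := by
  by_contra h
  push Not at h
  exact hr (hs ▸ auxZ.sum_mem fun i _ => h i)

/-- Normalised multipliers. -/
def AuxNorm {J : Type*} [Fintype J] (s t : J → ℝ) (r : ℝ) (ν κ lam : J → ℤ) (L K : ℤ) : Prop :=
  ∃ (n : J → ℤ) (L' K' : ℤ), 0 ≤ L' ∧ 0 ≤ K' ∧ (∀ i, 0 ≤ n i) ∧ (∀ i, n i ≤ lam i) ∧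
    (∀ i, n i ≤ κ i) ∧ (∀ i, 0 < n i → s i + t i = r) ∧ (∀ i, s i ∉ auxZ → lam i = L' + n i) ∧
    (∀ i, t i ∉ auxZ → κ i = K' + n i) ∧ L + K + ∑ i, ν i ≤ L' + K' + ∑ i, n i

lemma AuxNorm.swap {J : Type*} [Fintype J] {s t : J → ℝ} {r : ℝ} {ν κ lam : J → ℤ} {L K : ℤ}
    (h : AuxNorm t s r ν lam κ K L) : AuxNorm s t r ν κ lam L K := by
  obtain ⟨n, L', K', h1, h2, h3, h4, h5, h6, h7, h8, h9⟩ := h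
  exact ⟨n, K', L', h2, h1, h3, h5, h4, fun i hi => by rw [add_comm]; exact h6 i hi, h8, h7,
    by linarith⟩

lemma aux_norm1 {J : Type*} [Fintype J] [DecidableEq J] (s t : J → ℝ) (r : ℝ) (hr : r ∉ auxZ) (hr0 : 0 < r)
    (ν κ lam : J → ℤ) (L K : ℤ) (hs0 : ∀ j, 0 ≤ s j) (ht0 : ∀ j, 0 ≤ t j) (hs : ∑ j, s j = r)
    (ht : ∑ j, t j = r)
    (hκ : ∀ j, 0 ≤ κ j) (hlam : ∀ j, 0 ≤ lam j)
    (hνt : ∀ j, 0 < ν j → s j + t j = r)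
    (hs1 : ∀ j, 0 < s j → L + ν j ≤ lam j) 
    (hs2 : ∀ j, s j ∉ auxZ → lam j = L + ν j) (ht2 : ∀ j, t j ∉ auxZ → κ j = K + ν j)
    (l : J) (hl : 0 < ν l) (ho : ∀ j, j ≠ l → ν j = 0) (hsl : s l ∈ auxZ) :
    AuxNorm s t r ν κ lam L K := by
  have hsum : ∑ i, ν i = ν l := Finset.sum_eq_single l (fun j _ h => ho j h) (by simp)
  have hnt : t l ∉ auxZ := fun h => hr (hνt l hl ▸ auxZ.add_mem hsl h)
  have hL : 0 ≤ L := by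
    obtain ⟨i, hi⟩ := aux_ex_nonint s r hr hs
    have hil : i ≠ l := by rintro rfl; exact hi hsl
    have := hs2 i hi; rw [ho i hil] at this; have := hlam i; omega
  by_cases hB : ∃ j, j ≠ l ∧ t j ∉ auxZ
  · obtain ⟨j, hj, hjt⟩ := hB
    have hK : 0 ≤ K := by have := ht2 j hjt; rw [ho j hj] at this; have := hκ j; omega
    have hspos : 0 < s l := by
      rcases (hs0 l).lt_or_eq with h | h
      · exact h
      · exfalso
        have h1 : t l = r := by have := hνt l hl; linarith
        have h2 : t l + t j ≤ ∑ i, t i := by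
          rw [← Finset.sum_pair (f := t) hj.symm]
          exact sum_le_sum_of_subset_of_nonneg (subset_univ _) (fun i _ _ => ht0 i)
        have h3 : t j = 0 := by have := ht0 j; linarith
        apply hjt; rw [h3]; exact auxZ.zero_mem
    have hν0 : ∀ i, 0 ≤ ν i := fun i => by
      by_cases h : i = l
      · subst h; exact hl.le
      · rw [ho i h]
    refine ⟨ν, L, K, hL, hK, hν0, fun i => ?_, fun i => ?_, hνt, hs2, ht2, le_refl _⟩
    · by_cases h : i = l
      · subst h; have := hs1 i hspos; omega
      · rw [ho i h]; exact hlam i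
    · by_cases h : i = l
      · subst h; have := ht2 i hnt; omega
      · rw [ho i h]; exact hκ i
  · push Not at hB
    refine ⟨0, L, κ l, hL, hκ l, by simp, hlam, hκ, by simp, ?_, ?_, ?_⟩
    · intro i hi
      have hil : i ≠ l := by rintro rfl; exact hi hsl
      rw [hs2 i hi, ho i hil]; rfl
    · intro i hi
      have : i = l := by by_contra h; exact hi (hB i h)
      subst this; simp
    · rw [hsum, ht2 l hnt]; simp; linarith

lemma aux_norm {J : Type*} [Fintype J] [DecidableEq J] (s t : J → ℝ) (r : ℝ) (hr : r ∉ auxZ) (hr0 : 0 < r)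
    (ν κ lam : J → ℤ) (L K : ℤ) (hs0 : ∀ j, 0 ≤ s j) (ht0 : ∀ j, 0 ≤ t j) (hs : ∑ j, s j = r)
    (ht : ∑ j, t j = r)
    (hν : ∀ j, 0 ≤ ν j) (hκ : ∀ j, 0 ≤ κ j) (hlam : ∀ j, 0 ≤ lam j)
    (hνt : ∀ j, 0 < ν j → s j + t j = r)
    (hs1 : ∀ j, 0 < s j → L + ν j ≤ lam j) (ht1 : ∀ j, 0 < t j → K + ν j ≤ κ j)
    (hs2 : ∀ j, s j ∉ auxZ → lam j = L + ν j) (ht2 : ∀ j, t j ∉ auxZ → κ j = K + ν j) :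
    AuxNorm s t r ν κ lam L K := by
  obtain ⟨i1, hi1⟩ := aux_ex_nonint s r hr hs
  obtain ⟨j1, hj1⟩ := aux_ex_nonint t r hr ht
  by_cases hA : ∀ l, ν l = 0
  · have h1 := hs2 i1 hi1; have h2 := ht2 j1 hj1
    have h3 := hlam i1; have h4 := hκ j1
    rw [hA] at h1 h2
    exact ⟨ν, L, K, by omega, by omega, hν, fun i => by rw [hA]; exact hlam i,
      fun i => by rw [hA]; exact hκ i, hνt, hs2, ht2, le_refl _⟩
  push Not at hA
  obtain ⟨l, hl⟩ := hA
  have hl : 0 < ν l := by have := hν l; omega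
  by_cases hB : ∀ j, j ≠ l → ν j = 0
  · by_cases hsl : s l ∈ auxZ
    · exact aux_norm1 s t r hr hr0 ν κ lam L K hs0 ht0 hs ht hκ hlam hνt hs1 hs2 ht2 l hl hB hsl
    by_cases htl : t l ∈ auxZ
    · exact (aux_norm1 t s r hr hr0 ν lam κ K L ht0 hs0 ht hs hlam hκ
        (fun j hj => by rw [add_comm]; exact hνt j hj) ht1 ht2 hs2 l hl hB htl).swap
    have hrl := hνt l hl
    have hL : 0 ≤ L := by
      by_contra hneg
      apply htl
      have : s l = r := by
        have hz : ∀ i, i ≠ l → s i ∈ auxZ := by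
          intro i hi; by_contra h
          have := hs2 i h; rw [hB i hi] at this; have := hlam i; omega
        exfalso
        apply htl
        have e : t l = ∑ i ∈ univ.erase l, s i := by
          have := Finset.add_sum_erase univ s (mem_univ l); linarith
        rw [e]; exact auxZ.sum_mem fun i hi => hz i (ne_of_mem_erase hi)
      have : t l = 0 := by linarith
      rw [this]; exact auxZ.zero_mem
    have hK : 0 ≤ K := by
      by_contra hneg
      have hz : ∀ i, i ≠ l → t i ∈ auxZ := by
        intro i hi; by_contra h
        have := ht2 i h; rw [hB i hi] at this; have := hκ i; omega
      apply hsl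
      have e : s l = ∑ i ∈ univ.erase l, t i := by
        have := Finset.add_sum_erase univ t (mem_univ l); linarith
      rw [e]; exact auxZ.sum_mem fun i hi => hz i (ne_of_mem_erase hi)
    refine ⟨ν, L, K, hL, hK, hν, fun i => ?_, fun i => ?_, hνt, hs2, ht2, le_refl _⟩
    · by_cases h : i = l
      · subst h; have := hs2 i hsl; omega
      · rw [hB i h]; exact hlam i
    · by_cases h : i = l
      · subst h; have := ht2 i htl; omega
      · rw [hB i h]; exact hκ i
  push Not at hB
  obtain ⟨l', hne, hl'⟩ := hB
  have hl' : 0 < ν l' := by have := hν l'; omega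
  have h1 := hνt l hl
  have h2 := hνt l' hl'
  have htot : ∑ i, (s i + t i) = 2 * r := by rw [sum_add_distrib]; linarith
  have hz : ∀ i, i ≠ l → i ≠ l' → s i = 0 ∧ t i = 0 := by
    intro i h h'
    have h3 : ∑ j ∈ ({i, l, l'} : Finset J), (s j + t j) ≤ ∑ j, (s j + t j) :=
      sum_le_sum_of_subset_of_nonneg (subset_univ _) (fun i _ _ => add_nonneg (hs0 i) (ht0 i))
    rw [sum_insert (by simp [h, h']), sum_pair hne.symm] at h3
    have := hs0 i; have := ht0 i
    constructor <;> linarith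
  have hzν : ∀ i, i ≠ l → i ≠ l' → ν i = 0 := by
    intro i h h'
    by_contra h3
    have := hνt i (by have := hν i; omega)
    obtain ⟨e1, e2⟩ := hz i h h'
    linarith
  have hss : s l + s l' = r := by
    rw [← hs, ← sum_pair hne.symm]
    exact sum_subset (subset_univ _) (fun i _ hi => by
      simp only [mem_insert, mem_singleton, not_or] at hi; exact (hz i hi.1 hi.2).1)
  have hsν : ∑ i, ν i = ν l + ν l' := by
    rw [← sum_pair hne.symm]
    exact (sum_subset (subset_univ _) (fun i _ hi => by
      simp only [mem_insert, mem_singleton, not_or] at hi; exact (hzν i hi.1 hi.2))).symm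
  have ht_l : t l = s l' := by linarith
  have ht_l' : t l' = s l := by linarith
  have hSmem : ∀ i, s i ∉ auxZ → i = l ∨ i = l' := by
    intro i hi; by_contra h; push Not at h
    apply hi; rw [(hz i h.1 h.2).1]; exact auxZ.zero_mem
  have hTmem : ∀ i, t i ∉ auxZ → i = l ∨ i = l' := by
    intro i hi; by_contra h; push Not at h
    apply hi; rw [(hz i h.1 h.2).2]; exact auxZ.zero_mem
  by_cases c1 : s l ∈ auxZ
  · have c2 : s l' ∉ auxZ := fun h => hr (hss ▸ auxZ.add_mem c1 h)
    refine ⟨0, lam l', κ l, hlam _, hκ _, by simp, hlam, hκ, by simp, ?_, ?_, ?_⟩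
    · intro i hi
      rcases hSmem i hi with rfl | rfl
      · exact absurd c1 hi
      · simp
    · intro i hi
      rcases hTmem i hi with rfl | rfl
      · simp
      · rw [ht_l'] at hi; exact absurd c1 hi
    · rw [hsν, hs2 l' c2, ht2 l (ht_l ▸ c2)]; simp; linarith
  by_cases c2 : s l' ∈ auxZ
  · refine ⟨0, lam l, κ l', hlam _, hκ _, by simp, hlam, hκ, by simp, ?_, ?_, ?_⟩
    · intro i hi
      rcases hSmem i hi with rfl | rfl
      · simp
      · exact absurd c2 hi
    · intro i hi
      rcases hTmem i hi with rfl | rfl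
      · rw [ht_l] at hi; exact absurd c2 hi
      · simp
    · rw [hsν, hs2 l c1, ht2 l' (ht_l' ▸ c1)]; simp; linarith
  have q1 := hs2 l c1
  have q2 := hs2 l' c2
  have q3 := ht2 l (ht_l ▸ c2)
  have q4 := ht2 l' (ht_l' ▸ c1)
  have p1 := hlam l
  have p2 := hlam l'
  have p3 := hκ l
  have p4 := hκ l'
  set c := min (ν l) (ν l') with hc
  refine ⟨fun i => if i = l ∨ i = l' then ν i - c else 0, L + c, K + c, by omega, by omega,
    ?_, ?_, ?_, ?_, ?_, ?_, ?_⟩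
  · intro i; dsimp only; split_ifs with h
    · rcases h with rfl | rfl <;> omega
    · exact le_refl _
  · intro i; dsimp only; split_ifs with h
    · rcases h with rfl | rfl <;> omega
    · exact hlam i
  · intro i; dsimp only; split_ifs with h
    · rcases h with rfl | rfl <;> omega
    · exact hκ i
  · intro i; dsimp only; split_ifs with h
    · rcases h with rfl | rfl <;> intro _ <;> assumption
    · intro h; exact absurd h (lt_irrefl _)
  · intro i hi; have := hSmem i hi
    beta_reduce; rw [if_pos this]; rcases this with rfl | rfl <;> omega
  · intro i hi; have := hTmem i hi
    beta_reduce; rw [if_pos this]; rcases this with rfl | rfl <;> omega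
  · have : ∑ i, (if i = l ∨ i = l' then ν i - c else 0) = (ν l - c) + (ν l' - c) := by
      rw [← sum_pair (f := fun i => ν i - c) hne.symm, ← sum_filter]
      congr 1; ext i; simp
    rw [this, hsν]; linarith

def aind (a b θ : ℤ) : ℤ := if a ≤ θ ∧ θ < b then 1 else 0

def agg (a θ : ℤ) : ℤ := aind 0 a θ - aind a 0 θ

lemma aind_sum (a b B : ℤ) (hab : a ≤ b) (ha : -B ≤ a) (hb : b ≤ B) :
    ∑ θ ∈ Finset.Ico (-B) B, aind a b θ = b - a := by
  unfold aind
  rw [← Finset.sum_filter, sum_const]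
  have : (Finset.Ico (-B) B).filter (fun θ => a ≤ θ ∧ θ < b) = Finset.Ico a b := by
    ext θ; simp only [mem_filter, Finset.mem_Ico]; omega
  rw [this]; simp [hab]

lemma agg_sum (a B : ℤ) (ha : -B ≤ a) (hb : a ≤ B) :
    ∑ θ ∈ Finset.Ico (-B) B, agg a θ = a := by
  unfold agg
  rw [sum_sub_distrib]
  rcases le_total 0 a with h | h
  · rw [aind_sum 0 a B h (by omega) hb]
    have : ∀ θ ∈ Finset.Ico (-B) B, aind a 0 θ = 0 := by
      intro θ _; unfold aind; rw [if_neg]; omega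
    rw [sum_eq_zero this]; ring
  · rw [aind_sum a 0 B h ha (by omega)]
    have : ∀ θ ∈ Finset.Ico (-B) B, aind 0 a θ = 0 := by
      intro θ _; unfold aind; rw [if_neg]; omega
    rw [sum_eq_zero this]; ring

lemma agg_mono {a b : ℤ} (h : a ≤ b) (θ : ℤ) : agg a θ ≤ agg b θ := by
  unfold agg aind; split_ifs <;> omega

lemma agg_sub {a b : ℤ} (h : a ≤ b) (θ : ℤ) : agg a θ = agg b θ - aind a b θ := by
  unfold agg aind; split_ifs <;> omega

/-- The per-job contribution. -/
def auxT (w p q : ℝ) (μ κ lam n θ : ℤ) : ℝ :=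
  (w - p) * aind (μ - κ) μ θ + (w - q) * aind (μ - lam) μ θ - w * aind (μ - n) μ θ

lemma auxT_nonneg (w p q : ℝ) (μ κ lam n θ : ℤ) (hp : 0 ≤ p) (hq : 0 ≤ q) (hpq : p + q ≤ w)
    (hnk : n ≤ κ) (hnl : n ≤ lam) : 0 ≤ auxT w p q μ κ lam n θ := by
  unfold auxT aind
  split_ifs <;> first | (exfalso; omega) | (push_cast; linarith)

lemma auxT_pos1 (w p q s r : ℝ) (μ κ lam n θ : ℤ) (hp : 0 ≤ p) (hq : 0 ≤ q) (hpq : p + q ≤ w)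
    (hn : 0 ≤ n) (hwr : w - r ∈ auxZ) (hs : s ∉ auxZ)
    (hl : 0 < lam → q + s - r ∈ auxZ) (h1 : μ - lam ≤ θ) (h2 : θ < μ - n) :
    0 < auxT w p q μ κ lam n θ := by
  have hqs := hl (by omega)
  have hlt : q < w := by
    rcases (show q ≤ w by linarith).lt_or_eq with h | h
    · exact h
    · exfalso; apply hs
      have := auxZ.sub_mem hqs hwr
      rw [h] at this; convert this using 1; ring
  unfold auxT aind
  rw [if_pos (show μ - lam ≤ θ ∧ θ < μ by omega), if_neg (show ¬ (μ - n ≤ θ ∧ θ < μ) by omega)]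
  split_ifs <;> (push_cast; linarith)

lemma auxT_pos2 (w p q s r : ℝ) (μ κ lam n θ : ℤ) (hp : 0 ≤ p) (hq : 0 ≤ q) (hpq : p + q ≤ w)
    (hn : 0 ≤ n) (hwr : w - r ∈ auxZ) (hs : s ∉ auxZ)
    (hl : 0 < κ → p + s - r ∈ auxZ) (h1 : μ - κ ≤ θ) (h2 : θ < μ - n) :
    0 < auxT w p q μ κ lam n θ := by
  have := auxT_pos1 w q p s r μ lam κ n θ hq hp (by linarith) hn hwr hs hl h1 h2
  unfold auxT at this ⊢
  linarith

open Classical in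
lemma auxT_mod (w p q s t r : ℝ) (μ κ lam n θ : ℤ) (hn : 0 ≤ n) (hwr : w - r ∈ auxZ)
    (hnk : n ≤ κ) (hnl : n ≤ lam)
    (hl : 0 < lam → q + s - r ∈ auxZ) (hk : 0 < κ → p + t - r ∈ auxZ)
    (hnn : 0 < n → s + t = r) :
    auxT w p q μ κ lam n θ - ((if s ∉ auxZ then (if μ - lam ≤ θ ∧ θ < μ - n then s else 0) else 0) +
      (if t ∉ auxZ then (if μ - κ ≤ θ ∧ θ < μ - n then t else 0) else 0)) ∈ auxZ := by
  by_cases hN : μ - n ≤ θ ∧ θ < μ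
  · have a1 := hl (by omega)
    have a2 := hk (by omega)
    have a3 := hnn (by omega)
    rw [if_neg (show ¬ (μ - lam ≤ θ ∧ θ < μ - n) by omega),
      if_neg (show ¬ (μ - κ ≤ θ ∧ θ < μ - n) by omega)]
    unfold auxT aind
    rw [if_pos hN, if_pos (show μ - lam ≤ θ ∧ θ < μ by omega),
      if_pos (show μ - κ ≤ θ ∧ θ < μ by omega)]
    simp only [ite_self]
    have := auxZ.sub_mem hwr (auxZ.add_mem a1 a2)
    convert this using 1
    push_cast; linarith
  · have key : ∀ (q s : ℝ) (lam : ℤ), n ≤ lam → (0 < lam → q + s - r ∈ auxZ) →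
        (w - q) * aind (μ - lam) μ θ -
          (if s ∉ auxZ then (if μ - lam ≤ θ ∧ θ < μ - n then s else 0) else 0) ∈ auxZ := by
      intro q s lam hnl hl
      unfold aind
      by_cases hI : μ - lam ≤ θ ∧ θ < μ
      · rw [if_pos hI, if_pos (show μ - lam ≤ θ ∧ θ < μ - n by omega)]
        have a1 := auxZ.sub_mem hwr (hl (by omega))
        split_ifs with h
        · convert auxZ.add_mem a1 h using 1
          push_cast; ring
        · convert a1 using 1
          push_cast; ring
      · rw [if_neg hI, if_neg (show ¬ (μ - lam ≤ θ ∧ θ < μ - n) by omega)]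
        simp only [ite_self]
        simpa using auxZ.zero_mem
    have := auxZ.add_mem (key q s lam hnl hl) (key p t κ hnk hk)
    convert this using 1
    unfold auxT
    have e : aind (μ - n) μ θ = 0 := by unfold aind; rw [if_neg hN]
    rw [e]; push_cast; ring

lemma aux_fracsum {J : Type*} [Fintype J] (B : Finset J) (s : J → ℝ) (r : ℝ)
    (hB : ∀ j, j ∈ B ↔ s j ∉ auxZ) (hs : ∑ j, s j = r) : ∑ j ∈ B, s j - r ∈ auxZ := by
  classical
  have : ∑ j ∈ Bᶜ, s j ∈ auxZ := auxZ.sum_mem fun j hj => by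
    rw [mem_compl, hB] at hj; exact not_not.1 hj
  have h2 := Finset.sum_add_sum_compl B s
  convert auxZ.neg_mem this using 1
  linarith

lemma aux_core {J M : Type*} [Fintype J] [Fintype M] [DecidableEq J] [DecidableEq M]
    (G1 G2 : Finset M) (hdisj : Disjoint G1 G2) (hcover : G1 ∪ G2 = univ)
    (b : J → M → ℕ) (y : J → M → ℝ) (s t : J → ℝ) (r w : ℝ) (hr : r ∉ auxZ) (hw : 0 < w)
    (hwr : w - r ∈ auxZ) (hy0 : ∀ j h, 0 ≤ y j h) (hyb : ∀ j h, y j h ≤ b j h)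
    (hcol : ∀ h, ∑ j, y j h = w) (hs : ∑ j, s j = r) (ht : ∑ j, t j = r)
    (hrow : ∀ j, ∑ h, y j h ≤ w)
    (μ κ lam n : J → ℤ) (π : M → ℤ) (L K : ℤ) (hL : 0 ≤ L) (hK : 0 ≤ K)
    (hμ : ∀ j, 0 ≤ μ j) (hn : ∀ j, 0 ≤ n j) (hnk : ∀ j, n j ≤ κ j) (hnl : ∀ j, n j ≤ lam j)
    (hμt : ∀ j, 0 < μ j → ∑ h, y j h = w)
    (hκt : ∀ j, 0 < κ j → ∑ h ∈ G1, y j h + t j - r ∈ auxZ)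
    (hlt : ∀ j, 0 < lam j → ∑ h ∈ G2, y j h + s j - r ∈ auxZ)
    (hnt : ∀ j, 0 < n j → s j + t j = r)
    (hls : ∀ j, s j ∉ auxZ → lam j = L + n j) (hkt : ∀ j, t j ∉ auxZ → κ j = K + n j)
    (h1p : ∀ j, ∀ h ∈ G1, 0 < y j h → μ j - κ j ≤ π h)
    (h1n : ∀ j, ∀ h ∈ G1, y j h < b j h → π h ≤ μ j - κ j)
    (h2p : ∀ j, ∀ h ∈ G2, 0 < y j h → μ j - lam j ≤ π h)
    (h2n : ∀ j, ∀ h ∈ G2, y j h < b j h → π h ≤ μ j - lam j) :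
    L + K + ∑ j, n j ≤ ∑ j, κ j + ∑ j, lam j + ∑ h, π h - ∑ j, μ j := by
  classical
  have hκ0 : ∀ j, 0 ≤ κ j := fun j => (hn j).trans (hnk j)
  have hl0 : ∀ j, 0 ≤ lam j := fun j => (hn j).trans (hnl j)
  have hsplit : ∀ f : M → ℝ, ∑ h, f h = ∑ h ∈ G1, f h + ∑ h ∈ G2, f h := by
    intro f; rw [← hcover, sum_union hdisj]
  lift L to ℕ using hL
  lift K to ℕ using hK
  set F : ℤ → ℤ := fun θ => ∑ j, (aind (μ j - κ j) (μ j) θ + aind (μ j - lam j) (μ j) θ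
    - aind (μ j - n j) (μ j) θ) + ∑ h, agg (π h) θ - ∑ j, agg (μ j) θ with hF
  set p : J → ℝ := fun j => ∑ h ∈ G1, y j h with hp
  set q : J → ℝ := fun j => ∑ h ∈ G2, y j h with hq
  have hp0 : ∀ j, 0 ≤ p j := fun j => sum_nonneg fun h _ => hy0 j h
  have hq0 : ∀ j, 0 ≤ q j := fun j => sum_nonneg fun h _ => hy0 j h
  have hpq : ∀ j, p j + q j ≤ w := fun j => by rw [← hsplit]; exact hrow j
  set R : ℤ → ℝ := fun θ => ∑ j, (∑ h ∈ G1, y j h * ((agg (π h) θ : ℝ) - agg (μ j - κ j) θ)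
    + ∑ h ∈ G2, y j h * ((agg (π h) θ : ℝ) - agg (μ j - lam j) θ)) with hR
  have hid : ∀ θ, w * (F θ : ℝ) = ∑ j, auxT w (p j) (q j) (μ j) (κ j) (lam j) (n j) θ + R θ := by
    intro θ
    have e1 : w * ∑ h, (agg (π h) θ : ℝ) = ∑ j, (∑ h ∈ G1, y j h * (agg (π h) θ : ℝ) +
        ∑ h ∈ G2, y j h * (agg (π h) θ : ℝ)) := by
      simp_rw [← hsplit]
      rw [sum_comm, mul_sum]
      exact sum_congr rfl fun h _ => by rw [← sum_mul, hcol]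
    simp only [hF, hR]
    push_cast
    rw [mul_sub, mul_add, e1, mul_sum, mul_sum, ← sum_add_distrib, ← sum_sub_distrib,
      ← sum_add_distrib]
    refine sum_congr rfl fun j _ => ?_
    simp_rw [mul_sub]
    rw [sum_sub_distrib, sum_sub_distrib, ← sum_mul, ← sum_mul]
    have e2 : (p j + q j) * (agg (μ j) θ : ℝ) = w * (agg (μ j) θ : ℝ) := by
      rcases (hμ j).lt_or_eq with h | h
      · rw [← hsplit, hμt j h]
      · rw [← h]; simp [agg]
    rw [agg_sub (show μ j - κ j ≤ μ j by have := hκ0 j; omega),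
      agg_sub (show μ j - lam j ≤ μ j by have := hl0 j; omega)]
    unfold auxT
    change _ = _ + (_ - p j * _ + (_ - q j * _))
    push_cast
    linear_combination e2
  have hterm : ∀ j h (φ : ℤ) θ, (0 < y j h → φ ≤ π h) → (y j h < b j h → π h ≤ φ) →
      0 ≤ y j h * ((agg (π h) θ : ℝ) - agg φ θ) ∧ y j h * ((agg (π h) θ : ℝ) - agg φ θ) ∈ auxZ := by
    intro j h φ θ a1 a2
    rcases (hy0 j h).lt_or_eq with h0 | h0
    · have m := agg_mono (a1 h0) θ
      have m' : (agg φ θ : ℝ) ≤ agg (π h) θ := by exact_mod_cast m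
      refine ⟨mul_nonneg h0.le (by linarith), ?_⟩
      rcases (hyb j h).lt_or_eq with h1 | h1
      · have : φ = π h := le_antisymm (a1 h0) (a2 h1)
        rw [this]; simpa using auxZ.zero_mem
      · rw [h1]
        have := auxZ_int ((b j h : ℤ) * (agg (π h) θ - agg φ θ))
        convert this using 1; push_cast; ring
    · rw [← h0]; simpa using auxZ.zero_mem
  have hR0 : ∀ θ, 0 ≤ R θ := fun θ => sum_nonneg fun j _ => add_nonneg
    (sum_nonneg fun h hh => (hterm j h _ θ (h1p j h hh) (h1n j h hh)).1)
    (sum_nonneg fun h hh => (hterm j h _ θ (h2p j h hh) (h2n j h hh)).1)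
  have hRZ : ∀ θ, R θ ∈ auxZ := fun θ => auxZ.sum_mem fun j _ => auxZ.add_mem
    (auxZ.sum_mem fun h hh => (hterm j h _ θ (h1p j h hh) (h1n j h hh)).2)
    (auxZ.sum_mem fun h hh => (hterm j h _ θ (h2p j h hh) (h2n j h hh)).2)
  have hT0 : ∀ θ j, 0 ≤ auxT w (p j) (q j) (μ j) (κ j) (lam j) (n j) θ := fun θ j =>
    auxT_nonneg _ _ _ _ _ _ _ _ (hp0 j) (hq0 j) (hpq j) (hnk j) (hnl j)
  have hF0 : ∀ θ, 0 ≤ F θ := by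
    intro θ
    have : 0 ≤ w * (F θ : ℝ) := by rw [hid]; exact add_nonneg (sum_nonneg fun j _ => hT0 θ j) (hR0 θ)
    exact_mod_cast nonneg_of_mul_nonneg_right this hw
  have hF1 : ∀ θ j, 0 < auxT w (p j) (q j) (μ j) (κ j) (lam j) (n j) θ → 1 ≤ F θ := by
    intro θ j hj
    have : 0 < w * (F θ : ℝ) := by
      rw [hid]
      exact add_pos_of_pos_of_nonneg (sum_pos' (fun j _ => hT0 θ j) ⟨j, mem_univ _, hj⟩) (hR0 θ)
    have := (mul_pos_iff_of_pos_left hw).1 this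
    have : 0 < F θ := by exact_mod_cast this
    omega
  -- a bound
  set B : ℤ := ∑ j, (μ j + κ j + lam j) + ∑ h, |π h| with hB
  have hBj : ∀ j, μ j + κ j + lam j ≤ B := by
    intro j
    have := single_le_sum (f := fun j => μ j + κ j + lam j)
      (fun j _ => by have := hμ j; have := hκ0 j; have := hl0 j; omega) (mem_univ j)
    have h2 : 0 ≤ ∑ h, |π h| := sum_nonneg fun h _ => abs_nonneg _
    omega
  have hBh : ∀ h, |π h| ≤ B := by
    intro h
    have := single_le_sum (f := fun h => |π h|) (fun h _ => abs_nonneg _) (mem_univ h)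
    have h2 : 0 ≤ ∑ j, (μ j + κ j + lam j) := sum_nonneg
      fun j _ => by have := hμ j; have := hκ0 j; have := hl0 j; omega
    omega
  set B1 := univ.filter (fun j => s j ∉ auxZ) with hB1
  set B2 := univ.filter (fun j => t j ∉ auxZ) with hB2
  have m1 : ∀ j, j ∈ B1 ↔ s j ∉ auxZ := by intro j; simp [hB1]
  have m2 : ∀ j, j ∈ B2 ↔ t j ∉ auxZ := by intro j; simp [hB2]
  have main := aux_count L K r hr F (Finset.Ico (-B) B) (fun θ _ => hF0 θ) B1 B2
    (fun j => μ j - lam j) (fun j => μ j - κ j) s t (aux_fracsum B1 s r m1 hs)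
    (aux_fracsum B2 t r m2 ht) ?_ ?_ ?_
  · have hsumF : ∑ θ ∈ Finset.Ico (-B) B, F θ
        = ∑ j, (κ j + lam j - n j) + ∑ h, π h - ∑ j, μ j := by
      simp only [hF]
      rw [sum_sub_distrib, sum_add_distrib, sum_comm, sum_comm (t := (univ : Finset M)),
        sum_comm (t := (univ : Finset J)) (f := fun θ j => agg (μ j) θ)]
      congr 1
      · congr 1
        · refine sum_congr rfl fun j _ => ?_
          have := hμ j; have := hκ0 j; have := hl0 j; have := hn j
          have := hnk j; have := hBj j
          rw [sum_sub_distrib, sum_add_distrib, aind_sum, aind_sum, aind_sum] <;> omega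
        · exact sum_congr rfl fun h _ => agg_sum _ _ (by have := abs_le.1 (hBh h); omega)
            (by have := abs_le.1 (hBh h); omega)
      · exact sum_congr rfl fun j _ => by
          have := hμ j; have := hκ0 j; have := hl0 j; have := hBj j
          exact agg_sum _ _ (by omega) (by omega)
    rw [hsumF, sum_sub_distrib, sum_add_distrib] at main
    linarith
  · intro i hi θ hθ
    rw [m1] at hi
    have e := hls i hi
    rw [Finset.mem_Ico] at hθ ⊢
    have := hμ i; have := hκ0 i; have := hl0 i; have := hBj i; have := hn i
    refine ⟨by omega, hF1 θ i ?_⟩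
    exact auxT_pos1 w _ _ (s i) r _ _ _ _ _ (hp0 i) (hq0 i) (hpq i) (hn i) hwr hi (hlt i)
      (by omega) (by omega)
  · intro i hi θ hθ
    rw [m2] at hi
    have e := hkt i hi
    rw [Finset.mem_Ico] at hθ ⊢
    have := hμ i; have := hκ0 i; have := hl0 i; have := hBj i; have := hn i
    refine ⟨by omega, hF1 θ i ?_⟩
    exact auxT_pos2 w _ _ (t i) r _ _ _ _ _ (hp0 i) (hq0 i) (hpq i) (hn i) hwr hi (hκt i)
      (by omega) (by omega)
  · intro θ _
    have hm : ∑ j, (auxT w (p j) (q j) (μ j) (κ j) (lam j) (n j) θ -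
        ((if s j ∉ auxZ then (if μ j - lam j ≤ θ ∧ θ < μ j - n j then s j else 0) else 0) +
        (if t j ∉ auxZ then (if μ j - κ j ≤ θ ∧ θ < μ j - n j then t j else 0) else 0))) ∈ auxZ :=
      auxZ.sum_mem fun j _ => auxT_mod w (p j) (q j) (s j) (t j) r (μ j) (κ j) (lam j) (n j) θ
        (hn j) hwr (hnk j) (hnl j) (hlt j) (hκt j) (hnt j)
    rw [sum_sub_distrib, sum_add_distrib] at hm
    have e1 : ∑ i ∈ B1, (if θ ∈ Finset.Ico (μ i - lam i) (μ i - lam i + L) then s i else 0)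
        = ∑ j, (if s j ∉ auxZ then (if μ j - lam j ≤ θ ∧ θ < μ j - n j then s j else 0) else 0) := by
      rw [hB1, sum_filter]
      refine sum_congr rfl fun j _ => ?_
      by_cases h : s j ∉ auxZ
      · rw [if_pos h, if_pos h, show μ j - lam j + (L:ℤ) = μ j - n j by have := hls j h; omega]
        simp only [Finset.mem_Ico]
      · rw [if_neg h, if_neg h]
    have e2 : ∑ i ∈ B2, (if θ ∈ Finset.Ico (μ i - κ i) (μ i - κ i + K) then t i else 0)
        = ∑ j, (if t j ∉ auxZ then (if μ j - κ j ≤ θ ∧ θ < μ j - n j then t j else 0) else 0) := by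
      rw [hB2, sum_filter]
      refine sum_congr rfl fun j _ => ?_
      by_cases h : t j ∉ auxZ
      · rw [if_pos h, if_pos h, show μ j - κ j + (K:ℤ) = μ j - n j by have := hkt j h; omega]
        simp only [Finset.mem_Ico]
      · rw [if_neg h, if_neg h]
    rw [e1, e2]
    have h3 := auxZ.sub_mem (auxZ.add_mem hm (hRZ θ)) (auxZ_mul (F θ) hwr)
    convert h3 using 1
    have := hid θ
    linarith

lemma aux_dual {J C Q : Type*} [Fintype J] [Fintype C] [Fintype Q] [DecidableEq J] [DecidableEq C]
    (χ : Q → C → ℤ) (sg : Q → ℤ) (d : J → Q → ℝ) (k : C → ℝ) (up : J → C → ℝ) (Z : J → C → ℝ)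
    (r rlo : ℝ) (hrlo : rlo < r)
    (hcol : ∀ c, ∑ j, Z j c = k c + r)
    (hin : ∀ j q, (sg q : ℝ) * (∑ c, (χ q c : ℝ) * Z j c - r) ≤ d j q)
    (h0 : ∀ j c, 0 ≤ Z j c) (hu : ∀ j c, Z j c ≤ up j c)
    (hopt : ∀ (Z' : J → C → ℝ) (r' : ℝ), (∀ c, ∑ j, Z' j c = k c + r') →
      (∀ j q, (sg q : ℝ) * (∑ c, (χ q c : ℝ) * Z' j c - r') ≤ d j q) →
      (∀ j c, 0 ≤ Z' j c) → (∀ j c, Z' j c ≤ up j c) → rlo ≤ r' → r ≤ r') :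
    ∃ (N : ℕ) (m : C → ℤ) (l : J → Q → ℕ), 0 < N ∧
      (∀ j q, (sg q : ℝ) * (∑ c, (χ q c : ℝ) * Z j c - r) < d j q → l j q = 0) ∧
      (∀ j c, 0 < Z j c → m c + ∑ q, (l j q : ℤ) * (sg q * χ q c) ≤ 0) ∧
      (∀ j c, Z j c < up j c → 0 ≤ m c + ∑ q, (l j q : ℤ) * (sg q * χ q c)) ∧
      (N : ℤ) = ∑ c, m c + ∑ j, ∑ q, (l j q : ℤ) * sg q := by
  classical
  let E : C → (J × C) ⊕ Unit → ℤ := fun c v =>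
    Sum.elim (fun x : J × C => if x.2 = c then (1:ℤ) else 0) (fun _ => -1) v
  let A : J × Q → (J × C) ⊕ Unit → ℤ := fun k v =>
    Sum.elim (fun x : J × C => if x.1 = k.1 then sg k.2 * χ k.2 x.2 else 0) (fun _ => - sg k.2) v
  let mk : (J → C → ℝ) → ℝ → (J × C) ⊕ Unit → ℝ := fun Z r v =>
    Sum.elim (fun x : J × C => Z x.1 x.2) (fun _ => r) v
  have evE : ∀ (X : (J × C) ⊕ Unit → ℝ) c, ∑ v, (E c v : ℝ) * X v = ∑ j, X (Sum.inl (j, c)) - X (Sum.inr ()) := by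
    intro X c
    simp [E, Fintype.sum_sum_type, Fintype.sum_prod_type, sub_eq_add_neg]
  have evA : ∀ (X : (J × C) ⊕ Unit → ℝ) j q, ∑ v, (A (j, q) v : ℝ) * X v
      = (sg q : ℝ) * (∑ c, (χ q c : ℝ) * X (Sum.inl (j, c)) - X (Sum.inr ())) := by
    intro X j q
    simp only [A, Fintype.sum_sum_type, Fintype.sum_prod_type, Sum.elim_inl, Sum.elim_inr]
    rw [Finset.sum_eq_single j]
    · simp [sub_eq_add_neg, mul_assoc]; rw [← mul_sum]; ring
    · intro i _ hi; simp [hi]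
    · simp
  let obj : (J × C) ⊕ Unit → ℤ := fun v => Sum.elim (fun _ => (0:ℤ)) (fun _ => 1) v
  have evO : ∀ X : (J × C) ⊕ Unit → ℝ, ∑ v, (obj v : ℝ) * X v = X (Sum.inr ()) := by
    intro X
    simp [obj, Fintype.sum_sum_type]
  obtain ⟨N, m, l, hN, hl, hp, hn⟩ := aux_lp2 E k A (fun x => d x.1 x.2)
    (mk (fun _ _ => 0) rlo) (mk up (r + 1)) obj (mk Z r)
    (by intro c; rw [evE]; simp [mk, hcol])
    (by rintro ⟨j, q⟩; rw [evA]; exact hin j q)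
    (by
      rintro (⟨j, c⟩ | _)
      · exact h0 j c
      · exact hrlo.le)
    (by
      rintro (⟨j, c⟩ | _)
      · exact hu j c
      · exact (lt_add_one r).le)
    (by
      intro X' g1 g2 g3 g4
      rw [evO, evO]
      refine hopt (fun j c => X' (Sum.inl (j, c))) (X' (Sum.inr ())) (fun c => ?_) (fun j q => ?_)
        (fun j c => g3 (Sum.inl (j, c))) (fun j c => g4 (Sum.inl (j, c))) (g3 (Sum.inr ()))
      · have := g1 c; rw [evE] at this; linarith
      · have := g2 (j, q); rw [evA] at this; exact this)
  have evV : ∀ j c, ∑ k, m k * E k (Sum.inl (j, c)) + ∑ k, (l k : ℤ) * A k (Sum.inl (j, c))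
      + N * obj (Sum.inl (j, c)) = m c + ∑ q, (l (j, q) : ℤ) * (sg q * χ q c) := by
    intro j c
    simp [E, A, obj, Fintype.sum_prod_type]
  refine ⟨N, m, fun j q => l (j, q), hN, ?_, ?_, ?_, ?_⟩
  · intro j q h
    exact hl (j, q) (by rw [evA]; exact h)
  · intro j c h
    have := hp (Sum.inl (j, c)) h
    rwa [evV] at this
  · intro j c h
    have := hn (Sum.inl (j, c)) h
    rwa [evV] at this
  · have a1 := hp (Sum.inr ()) hrlo
    have a2 := hn (Sum.inr ()) (lt_add_one r)
    have : ∑ k, m k * E k (Sum.inr ()) + ∑ k, (l k : ℤ) * A k (Sum.inr ()) + N * obj (Sum.inr ())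
        = - ∑ c, m c - ∑ j, ∑ q, (l (j, q) : ℤ) * sg q + N := by
      simp [E, A, obj, Fintype.sum_prod_type, sub_eq_add_neg]
    rw [this] at a1 a2
    beta_reduce; omega

lemma aux_contra {J M : Type*} [Fintype J] [Fintype M] [DecidableEq J] [DecidableEq M]
    (G1 G2 : Finset M) (hG1ne : G1.Nonempty)
    (hdisj : Disjoint G1 G2) (hcover : G1 ∪ G2 = Finset.univ)
    (b : J → M → ℕ) (a1 a2 : J → ℕ) (rstar wstar : ℝ)
    (y : J → M → ℝ) (x1 x2 : J → ℝ) (r w : ℝ)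
    (hfeas : FeasibleLP G1 G2 b a1 a2 rstar wstar y x1 x2 r w)
    (hopt : ∀ y' x1' x2' r' w',
      FeasibleLP G1 G2 b a1 a2 rstar wstar y' x1' x2' r' w' → r ≤ r')
    (ε : ℝ) (hε0 : 0 < ε) (hε1 : ε < 1) (hrε : r = (⌊rstar⌋ : ℝ) + ε)
    (hsat1 : ∀ h ∈ G1, ((∑ j, y j h) = w) ∧
      (w = (∑ j, (b j h : ℝ)) - ((∑ j, (a2 j : ℝ)) - r)))
    (hsat2 : ∀ h ∈ G2, ((∑ j, y j h) = w) ∧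
      (w = (∑ j, (b j h : ℝ)) - ((∑ j, (a1 j : ℝ)) - r))) : False := by
  have hr : r ∉ auxZ := by
    rintro ⟨z, hz⟩
    have hz : (z : ℝ) = r := hz
    rw [hrε] at hz
    have h1 : ((⌊rstar⌋ : ℤ) : ℝ) < z := by linarith
    have h2 : (z : ℝ) < ((⌊rstar⌋ + 1 : ℤ) : ℝ) := by push_cast; linarith
    have h1 : ⌊rstar⌋ < z := by exact_mod_cast h1
    have h2 : z < ⌊rstar⌋ + 1 := by exact_mod_cast h2
    omega
  obtain ⟨⟨f1, f2, f3, f4, f5, f6, f7, f8, f9, f10, f11⟩, hwk, hrl⟩ := hfeas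
  have hwr : w - r ∈ auxZ := by rw [hwk]; exact auxZ_int _
  have hmem : ∀ h, h ∈ G1 ∨ h ∈ G2 := fun h => by rw [← mem_union, hcover]; exact mem_univ h
  have hcolw : ∀ h, ∑ j, y j h = w := fun h => by
    rcases hmem h with h' | h'
    · exact (hsat1 h h').1
    · exact (hsat2 h h').1
  have hw : 0 < w := by
    obtain ⟨h, hh⟩ := hG1ne
    have h0 : 0 ≤ w := by rw [← hcolw h]; exact sum_nonneg fun j _ => (f4 j h).1
    rcases h0.lt_or_eq with h1 | h1
    · exact h1
    · exfalso; apply hr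
      rw [← h1] at hwr
      simpa using hwr
  have hr0 : 0 < r := by
    have h0 : 0 ≤ r := by rw [← f5]; exact sum_nonneg fun j _ => (f8 j).1
    rcases h0.lt_or_eq with h1 | h1
    · exact h1
    · exfalso; apply hr; rw [← h1]; exact auxZ.zero_mem
  have hsplit : ∀ f : M → ℝ, ∑ h, f h = ∑ h ∈ G1, f h + ∑ h ∈ G2, f h := by
    intro f; rw [← hcover, sum_union hdisj]
  let χ : Fin 4 → M ⊕ Bool → ℤ := ![Sum.elim (fun _ => 1) (fun _ => 0),
    Sum.elim (fun _ => 0) (fun _ => 1),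
    Sum.elim (fun h => if h ∈ G1 then 1 else 0) (fun β => if β = true then 1 else 0),
    Sum.elim (fun h => if h ∈ G2 then 1 else 0) (fun β => if β = true then 0 else 1)]
  let sg : Fin 4 → ℤ := ![1, 1, -1, -1]
  let d : J → Fin 4 → ℝ := fun j => ![w - r, 0,
    -((∑ h ∈ G1, (b j h : ℝ)) + a2 j - ∑ j', (a2 j' : ℝ)),
    -((∑ h ∈ G2, (b j h : ℝ)) + a1 j - ∑ j', (a1 j' : ℝ))]
  let kk : M ⊕ Bool → ℝ := Sum.elim (fun _ => w - r) (fun _ => 0)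
  let mk : (J → M → ℝ) → (J → ℝ) → (J → ℝ) → J → M ⊕ Bool → ℝ := fun y s t j =>
    Sum.elim (y j) (fun β => if β = true then t j else s j)
  have ev0 : ∀ z : M ⊕ Bool → ℝ, ∑ c, (χ 0 c : ℝ) * z c = ∑ h, z (Sum.inl h) := by
    intro z; simp [χ, Fintype.sum_sum_type]
  have ev1 : ∀ z : M ⊕ Bool → ℝ, ∑ c, (χ 1 c : ℝ) * z c
      = z (Sum.inr false) + z (Sum.inr true) := by
    intro z; simp [χ, Fintype.sum_sum_type]; ring
  have ev2 : ∀ z : M ⊕ Bool → ℝ, ∑ c, (χ 2 c : ℝ) * z c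
      = ∑ h ∈ G1, z (Sum.inl h) + z (Sum.inr true) := by
    intro z; simp [χ, Fintype.sum_sum_type]
  have ev3 : ∀ z : M ⊕ Bool → ℝ, ∑ c, (χ 3 c : ℝ) * z c
      = ∑ h ∈ G2, z (Sum.inl h) + z (Sum.inr false) := by
    intro z; simp [χ, Fintype.sum_sum_type]
  have s0 : (sg 0 : ℝ) = 1 := by simp [sg]
  have s1 : (sg 1 : ℝ) = 1 := by simp [sg]
  have s2 : (sg 2 : ℝ) = -1 := by simp [sg]
  have s3 : (sg 3 : ℝ) = -1 := by simp [sg]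
  have f10' : ∀ j, -1 * ((∑ h ∈ G1, y j h + x2 j) - r)
      ≤ -((∑ h ∈ G1, (b j h : ℝ)) + a2 j - ∑ j', (a2 j' : ℝ)) := by
    intro j; have := f10 j; rw [sum_sub_distrib] at this; linarith
  have f11' : ∀ j, -1 * ((∑ h ∈ G2, y j h + x1 j) - r)
      ≤ -((∑ h ∈ G2, (b j h : ℝ)) + a1 j - ∑ j', (a1 j' : ℝ)) := by
    intro j; have := f11 j; rw [sum_sub_distrib] at this; linarith
  obtain ⟨N, m, l, hN, hl, hp, hn, htot⟩ := aux_dual χ sg d kk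
    (mk (fun j h => (b j h : ℝ)) (fun j => (a1 j : ℝ)) (fun j => (a2 j : ℝ))) (mk y x1 x2)
    r (⌊rstar⌋ : ℝ) (by linarith)
    (by
      rintro (h | β)
      · simp [mk, kk, hcolw]
      · cases β
        · simp [mk, kk, f5]
        · simp [mk, kk, f6])
    (by
      intro j q
      fin_cases q
      · change (sg 0 : ℝ) * (∑ c, (χ 0 c : ℝ) * _ - r) ≤ w - r
        rw [ev0, s0]; have := f3 j; simp only [mk, Sum.elim_inl]; linarith
      · change (sg 1 : ℝ) * (∑ c, (χ 1 c : ℝ) * _ - r) ≤ 0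
        rw [ev1, s1]; have := f7 j; simp [mk]; linarith
      · change (sg 2 : ℝ) * (∑ c, (χ 2 c : ℝ) * _ - r) ≤ _
        rw [ev2, s2]; exact f10' j
      · change (sg 3 : ℝ) * (∑ c, (χ 3 c : ℝ) * _ - r) ≤ _
        rw [ev3, s3]; exact f11' j)
    (by
      rintro j (h | _ | _)
      · exact (f4 j h).1
      · exact (f8 j).1
      · exact (f9 j).1)
    (by
      rintro j (h | _ | _)
      · exact (f4 j h).2
      · exact (f8 j).2
      · exact (f9 j).2)
    (by
      intro Z' r' g1 g2 g3 g4 g5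
      have gM : ∀ h, ∑ j, Z' j (Sum.inl h) = w - r + r' := fun h => g1 (Sum.inl h)
      have gs : ∑ j, Z' j (Sum.inr false) = 0 + r' := g1 (Sum.inr false)
      have gt : ∑ j, Z' j (Sum.inr true) = 0 + r' := g1 (Sum.inr true)
      refine hopt (fun j h => Z' j (Sum.inl h)) (fun j => Z' j (Sum.inr false))
        (fun j => Z' j (Sum.inr true)) r' (w - r + r')
        ⟨⟨?_, ?_, ?_, ?_, ?_, ?_, ?_, ?_, ?_, ?_, ?_⟩, ?_, g5⟩
      · intro h hh
        have := (hsat1 h hh).2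
        have := gM h
        constructor <;> linarith
      · intro h hh
        have := (hsat2 h hh).2
        have := gM h
        constructor <;> linarith
      · intro j
        have : (sg 0 : ℝ) * (∑ c, (χ 0 c : ℝ) * Z' j c - r') ≤ w - r := g2 j 0
        rw [ev0, s0] at this; linarith
      · intro j h; exact ⟨g3 j _, g4 j (Sum.inl h)⟩
      · linarith
      · linarith
      · intro j
        have : (sg 1 : ℝ) * (∑ c, (χ 1 c : ℝ) * Z' j c - r') ≤ 0 := g2 j 1
        rw [ev1, s1] at this; linarith
      · intro j; exact ⟨g3 j _, g4 j (Sum.inr false)⟩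
      · intro j; exact ⟨g3 j _, g4 j (Sum.inr true)⟩
      · intro j
        have : (sg 2 : ℝ) * (∑ c, (χ 2 c : ℝ) * Z' j c - r')
          ≤ -((∑ h ∈ G1, (b j h : ℝ)) + a2 j - ∑ j', (a2 j' : ℝ)) := g2 j 2
        rw [ev2, s2] at this; rw [sum_sub_distrib]; linarith
      · intro j
        have : (sg 3 : ℝ) * (∑ c, (χ 3 c : ℝ) * Z' j c - r')
          ≤ -((∑ h ∈ G2, (b j h : ℝ)) + a1 j - ∑ j', (a1 j' : ℝ)) := g2 j 3
        rw [ev3, s3] at this; rw [sum_sub_distrib]; linarith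
      · linarith)
  have n12 : ∀ h ∈ G1, h ∉ G2 := fun h hh => Finset.disjoint_left.1 hdisj hh
  have n21 : ∀ h ∈ G2, h ∉ G1 := fun h hh => Finset.disjoint_right.1 hdisj hh
  set μ : J → ℤ := fun j => (l j 0 : ℤ) with hμ
  set ν : J → ℤ := fun j => (l j 1 : ℤ) with hν
  set κ : J → ℤ := fun j => (l j 2 : ℤ) with hκ
  set lam : J → ℤ := fun j => (l j 3 : ℤ) with hlam
  set π : M → ℤ := fun h => - m (Sum.inl h) with hπ
  set L : ℤ := m (Sum.inr false) with hL
  set K : ℤ := m (Sum.inr true) with hK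
  have htot' : (N : ℤ) = L + K - ∑ h, π h + ∑ j, μ j + ∑ j, ν j - ∑ j, κ j - ∑ j, lam j := by
    rw [htot]
    simp only [Fintype.sum_sum_type, Fin.sum_univ_four, Fintype.sum_bool, hπ, sum_neg_distrib,
      sum_add_distrib, hμ, hν, hκ, hlam, hL, hK]
    simp [sg]; ring
  have ce1 : ∀ j, ∀ h ∈ G1, m (Sum.inl h) + ∑ q, (l j q : ℤ) * (sg q * χ q (Sum.inl h))
      = - π h + μ j - κ j := by
    intro j h hh
    simp [Fin.sum_univ_four, sg, χ, hh, n12 h hh, hπ, hμ, hκ]; ring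
  have ce2 : ∀ j, ∀ h ∈ G2, m (Sum.inl h) + ∑ q, (l j q : ℤ) * (sg q * χ q (Sum.inl h))
      = - π h + μ j - lam j := by
    intro j h hh
    simp [Fin.sum_univ_four, sg, χ, hh, n21 h hh, hπ, hμ, hlam]; ring
  have ces : ∀ j, m (Sum.inr false) + ∑ q, (l j q : ℤ) * (sg q * χ q (Sum.inr false))
      = L + ν j - lam j := by
    intro j
    simp [Fin.sum_univ_four, sg, χ, hν, hlam, hL]; ring
  have cet : ∀ j, m (Sum.inr true) + ∑ q, (l j q : ℤ) * (sg q * χ q (Sum.inr true))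
      = K + ν j - κ j := by
    intro j
    simp [Fin.sum_univ_four, sg, χ, hν, hκ, hK]; ring
  have sp : ∀ j, 0 < x1 j → L + ν j ≤ lam j := fun j h => by
    have := hp j (Sum.inr false) h; rw [ces] at this; omega
  have sn : ∀ j, x1 j < a1 j → lam j ≤ L + ν j := fun j h => by
    have := hn j (Sum.inr false) h; rw [ces] at this; omega
  have tp : ∀ j, 0 < x2 j → K + ν j ≤ κ j := fun j h => by
    have := hp j (Sum.inr true) h; rw [cet] at this; omega
  have tn : ∀ j, x2 j < a2 j → κ j ≤ K + ν j := fun j h => by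
    have := hn j (Sum.inr true) h; rw [cet] at this; omega
  have nonint : ∀ (x : ℝ) (a : ℕ), x ∉ auxZ → 0 ≤ x ∧ x ≤ a → 0 < x ∧ x < a := by
    rintro x a hx ⟨h1, h2⟩
    refine ⟨lt_of_le_of_ne h1 ?_, lt_of_le_of_ne h2 ?_⟩
    · rintro rfl; exact hx auxZ.zero_mem
    · rintro rfl; exact hx (by simpa using auxZ_int (a : ℤ))
  have tight : ∀ j q, 0 < (l j q : ℤ) →
      ¬ (sg q : ℝ) * (∑ c, (χ q c : ℝ) * mk y x1 x2 j c - r) < d j q := by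
    intro j q h h'
    have := hl j q h'
    omega
  have hμt : ∀ j, 0 < μ j → ∑ h, y j h = w := by
    intro j h
    have : ¬ (sg 0 : ℝ) * (∑ c, (χ 0 c : ℝ) * mk y x1 x2 j c - r) < w - r := tight j 0 h
    rw [ev0, s0] at this
    have h3 := f3 j
    simp only [mk, Sum.elim_inl] at this
    linarith
  have hνt : ∀ j, 0 < ν j → x1 j + x2 j = r := by
    intro j h
    have : ¬ (sg 1 : ℝ) * (∑ c, (χ 1 c : ℝ) * mk y x1 x2 j c - r) < 0 := tight j 1 h
    rw [ev1, s1] at this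
    have h3 := f7 j
    simp [mk] at this
    linarith
  have hκt : ∀ j, 0 < κ j → ∑ h ∈ G1, y j h + x2 j - r ∈ auxZ := by
    intro j h
    have : ¬ (sg 2 : ℝ) * (∑ c, (χ 2 c : ℝ) * mk y x1 x2 j c - r)
      < -((∑ h ∈ G1, (b j h : ℝ)) + a2 j - ∑ j', (a2 j' : ℝ)) := tight j 2 h
    rw [ev2, s2] at this
    have h3 := f10' j
    have h4 : ¬ (-1 * ((∑ h ∈ G1, y j h + x2 j) - r)
      < -((∑ h ∈ G1, (b j h : ℝ)) + a2 j - ∑ j', (a2 j' : ℝ))) := this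
    have h5 : ∑ h ∈ G1, y j h + x2 j - r
      = (((∑ h ∈ G1, (b j h : ℤ)) + a2 j - ∑ j', (a2 j' : ℤ) : ℤ) : ℝ) := by
      push_cast; linarith
    rw [h5]; exact auxZ_int _
  have hlt : ∀ j, 0 < lam j → ∑ h ∈ G2, y j h + x1 j - r ∈ auxZ := by
    intro j h
    have : ¬ (sg 3 : ℝ) * (∑ c, (χ 3 c : ℝ) * mk y x1 x2 j c - r)
      < -((∑ h ∈ G2, (b j h : ℝ)) + a1 j - ∑ j', (a1 j' : ℝ)) := tight j 3 h
    rw [ev3, s3] at this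
    have h3 := f11' j
    have h4 : ¬ (-1 * ((∑ h ∈ G2, y j h + x1 j) - r)
      < -((∑ h ∈ G2, (b j h : ℝ)) + a1 j - ∑ j', (a1 j' : ℝ))) := this
    have h5 : ∑ h ∈ G2, y j h + x1 j - r
      = (((∑ h ∈ G2, (b j h : ℤ)) + a1 j - ∑ j', (a1 j' : ℤ) : ℤ) : ℝ) := by
      push_cast; linarith
    rw [h5]; exact auxZ_int _
  have norm : AuxNorm x1 x2 r ν κ lam L K := aux_norm x1 x2 r hr hr0 ν κ lam L K
    (fun j => (f8 j).1) (fun j => (f9 j).1) f5 f6 (fun j => Int.natCast_nonneg _)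
    (fun j => Int.natCast_nonneg _) (fun j => Int.natCast_nonneg _) hνt sp tp
    (fun j hj => by
      obtain ⟨u1, u2⟩ := nonint _ _ hj (f8 j)
      exact le_antisymm (sn j u2) (sp j u1))
    (fun j hj => by
      obtain ⟨u1, u2⟩ := nonint _ _ hj (f9 j)
      exact le_antisymm (tn j u2) (tp j u1))
  obtain ⟨n, L', K', hL', hK', n0, nl, nk, nt, ls, kt, hle⟩ := norm
  have fin := aux_core G1 G2 hdisj hcover b y x1 x2 r w hr hw hwr (fun j h => (f4 j h).1)
    (fun j h => (f4 j h).2) hcolw f5 f6 f3 μ κ lam n π L' K' hL' hK'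
    (fun j => Int.natCast_nonneg _) n0 nk nl hμt hκt hlt nt ls kt
    (fun j h hh hy => by
      have := hp j (Sum.inl h) hy; rw [ce1 j h hh] at this; omega)
    (fun j h hh hy => by
      have := hn j (Sum.inl h) hy; rw [ce1 j h hh] at this; omega)
    (fun j h hh hy => by
      have := hp j (Sum.inl h) hy; rw [ce2 j h hh] at this; omega)
    (fun j h hh hy => by
      have := hn j (Sum.inl h) hy; rw [ce2 j h hh] at this; omega)
  have : (0:ℤ) < N := by exact_mod_cast hN
  linarith

theorem fractional_parts_B1
    {J M : Type*} [Fintype J] [Fintype M] [DecidableEq J] [DecidableEq M]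
    (G1 G2 : Finset M) (hG1ne : G1.Nonempty) (hG2ne : G2.Nonempty)
    (hdisj : Disjoint G1 G2) (hcover : G1 ∪ G2 = Finset.univ)
    (b : J → M → ℕ) (a1 a2 : J → ℕ)
    (ystar : J → M → ℝ) (x1star x2star : J → ℝ) (rstar wstar : ℝ)
    (hstar : FeasibleS G1 G2 b a1 a2 ystar x1star x2star rstar wstar)
    (hstaropt : ∀ y' x1' x2' r' w', FeasibleS G1 G2 b a1 a2 y' x1' x2' r' w' →
      wstar - rstar ≤ w' - r')
    (y : J → M → ℝ) (x1 x2 : J → ℝ) (r w : ℝ)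
    (hfeas : FeasibleLP G1 G2 b a1 a2 rstar wstar y x1 x2 r w)
    (hopt : ∀ y' x1' x2' r' w',
      FeasibleLP G1 G2 b a1 a2 rstar wstar y' x1' x2' r' w' → r ≤ r')
    (ε : ℝ) (hε0 : 0 < ε) (hε1 : ε < 1) (hrε : r = (⌊rstar⌋ : ℝ) + ε)
    (hsat1 : ∀ h ∈ G1, ((∑ j, y j h) = w) ∧
      (w = (∑ j, (b j h : ℝ)) - ((∑ j, (a2 j : ℝ)) - r)))
    (hsat2 : ∀ h ∈ G2, ((∑ j, y j h) = w) ∧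
      (w = (∑ j, (b j h : ℝ)) - ((∑ j, (a1 j : ℝ)) - r)))
    (B1 B2 : Finset J)
    (hB1 : ∀ j, j ∈ B1 ↔ ¬∃ z : ℤ, x1 j = (z : ℝ))
    (hB2 : ∀ j, j ∈ B2 ↔ ¬∃ z : ℤ, x2 j = (z : ℝ))
    (g : J) (hg : g ∈ B1)
    (εg lamg omgg : ℝ) (heg0 : 0 < εg) (heg1 : εg < 1)
    (hlamg0 : 0 ≤ lamg) (hlamg1 : lamg < 1) (homgg0 : 0 ≤ omgg) (homgg1 : omgg < 1)
    (hx : x1 g = (⌊x1 g⌋ : ℝ) + εg)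
    (hβ : (∑ h ∈ G2, y g h) = (⌊(∑ h ∈ G2, y g h)⌋ : ℝ) + lamg)
    (hα : (∑ h ∈ G1, y g h) = (⌊(∑ h ∈ G1, y g h)⌋ : ℝ) + omgg) :
    omgg = εg ∧ (εg ≤ ε → lamg = ε - εg) ∧ (ε < εg → lamg = 1 - (εg - ε)) := by
  exact (aux_contra G1 G2 hG1ne hdisj hcover b a1 a2 rstar wstar y x1 x2 r w hfeas hopt ε hε0 hε1 hrε
    hsat1 hsat2).elim
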